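/- The set S_∞^{loc} = {y ∈ [0, 2/3] : L(y) contains infinitely many local level sets, i.e. the number of equivalence classes of ~ contained in L(y) is infinite} is residual in [0, 2/3]: its complement within [0, 2/3] is meager. Moreover, the set S_∞^{loc,uc} = {y ∈ [0, 2/3] : L(y) contains uncountably many local level sets} intersects every nonempty open interval (a, b) ⊆ [0, 2/3] in a set of cardinality continuum. -/

import Mathlib

open Set MeasureTheory ENNReal

/-- `phi x` is the distance from `x` to the nearest integer. -/
noncomputable def phi (x : ℝ) : ℝ := |x - (round x : ℤ)|

/-- The Takagi function. -/
noncomputable def T (x : ℝ) : ℝ := ∑' n : ℕ, phi (2 ^ n * x) / 2 ^ n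

/-- The `n`-th binary digit of `x` (terminating expansion for dyadic rationals). -/
noncomputable def eps (n : ℕ) (x : ℝ) : ℤ := ⌊2 ^ n * x⌋ - 2 * ⌊2 ^ (n - 1) * x⌋

/-- `D k x = ∑_{j=1}^k (-1)^{ε_j(x)}`, the excess of 0 digits over 1 digits. -/
noncomputable def D (k : ℕ) (x : ℝ) : ℤ := ∑ j ∈ Finset.Icc 1 k, (1 - 2 * eps j x)

/-- The level set of the Takagi function at level `y`. -/
def L (y : ℝ) : Set ℝ := {x | x ∈ Set.Icc (0:ℝ) 1 ∧ T x = y}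

/-- `x` is a balanced dyadic rational of order `m`. -/
def BalancedOfOrder (x : ℝ) (m : ℕ) : Prop :=
  x ∈ Set.Ico (0:ℝ) 1 ∧ (∃ k : ℤ, x = (k : ℝ) / 2 ^ (2 * m)) ∧ D (2 * m) x = 0

/-- The generation of a balanced dyadic rational of order `m`:
the number of indices `1 ≤ j ≤ 2m` with `D j x = 0`. -/
noncomputable def generation (x : ℝ) (m : ℕ) : ℕ :=
  ((Finset.Icc 1 (2 * m)).filter (fun j => D j x = 0)).card

/-- A balanced dyadic rational of order `m` is leading if `D j x ≥ 0` for all `1 ≤ j ≤ 2m`. -/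
def Leading (x : ℝ) (m : ℕ) : Prop := ∀ j ∈ Finset.Icc 1 (2 * m), 0 ≤ D j x

/-- The equivalence relation whose classes are the local level sets. -/
def locSetoid : Setoid ℝ where
  r x x' := ∀ n : ℕ, 1 ≤ n → |D n x| = |D n x'|
  iseqv := ⟨fun _ _ _ => rfl, fun h n hn => (h n hn).symm,
    fun h g n hn => (h n hn).trans (g n hn)⟩

/-- The set of local level sets contained in `L y`: the image of `L y ∩ [0,1)`
under the quotient map of `locSetoid`. -/
def locClasses (y : ℝ) : Set (Quotient locSetoid) :=
  Quotient.mk locSetoid '' (L y ∩ Set.Ico (0:ℝ) 1)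

/-! ### Functional equations of the Takagi function -/

lemma phi_nonneg (x : ℝ) : 0 ≤ phi x := abs_nonneg _

lemma phi_le_half (x : ℝ) : phi x ≤ 1 / 2 := abs_sub_round x

lemma phi_add_intCast (x : ℝ) (k : ℤ) : phi (x + k) = phi x := by
  simp [phi, round_add_intCast]

lemma phi_eq_self {x : ℝ} (h0 : 0 ≤ x) (h1 : x ≤ 1 / 2) : phi x = x := by
  rw [phi, abs_sub_round_eq_min]
  rw [Int.fract_eq_self.2 ⟨h0, by linarith⟩]
  exact min_eq_left (by linarith)

lemma phi_eq_one_sub {x : ℝ} (h0 : 1 / 2 ≤ x) (h1 : x ≤ 1) : phi x = 1 - x := by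
  rcases h1.eq_or_lt with rfl | h1
  · simp [phi]
  rw [phi, abs_sub_round_eq_min]
  rw [Int.fract_eq_self.2 ⟨by linarith, h1⟩]
  exact min_eq_right (by linarith)

lemma continuous_phi : Continuous phi := by
  have h : phi = fun x : ℝ => Metric.infDist x (range ((↑) : ℤ → ℝ)) := by
    funext x
    apply le_antisymm
    · refine (Metric.le_infDist (range_nonempty _)).2 ?_
      rintro _ ⟨k, rfl⟩
      exact round_le x k
    · exact Metric.infDist_le_dist_of_mem ⟨round x, rfl⟩
  rw [h]
  exact Metric.continuous_infDist_pt _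

lemma takagi_term_le (n : ℕ) (x : ℝ) : phi (2 ^ n * x) / 2 ^ n ≤ 1 / 2 * (1 / 2) ^ n := by
  rw [div_eq_mul_inv, one_div_pow, ← one_div (2 ^ n : ℝ)]
  exact mul_le_mul_of_nonneg_right (phi_le_half _) (by positivity)

lemma takagi_term_nonneg (n : ℕ) (x : ℝ) : 0 ≤ phi (2 ^ n * x) / 2 ^ n :=
  div_nonneg (phi_nonneg _) (by positivity)

lemma summable_half_geometric : Summable fun n : ℕ => (1 / 2 : ℝ) * (1 / 2) ^ n :=
  summable_geometric_two.mul_left _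

lemma summable_takagi (x : ℝ) : Summable fun n : ℕ => phi (2 ^ n * x) / 2 ^ n :=
  summable_half_geometric.of_nonneg_of_le (takagi_term_nonneg · x) (takagi_term_le · x)

lemma continuous_T : Continuous T := by
  refine continuous_tsum (fun n => ?_) summable_half_geometric fun n x => ?_
  · exact (continuous_phi.comp (continuous_const.mul continuous_id)).div_const _
  · rw [Real.norm_of_nonneg (takagi_term_nonneg n x)]
    exact takagi_term_le n x

lemma T_nonneg (x : ℝ) : 0 ≤ T x := tsum_nonneg (takagi_term_nonneg · x)

lemma T_le_one (x : ℝ) : T x ≤ 1 := by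
  refine ((summable_takagi x).tsum_le_tsum (takagi_term_le · x) summable_half_geometric).trans ?_
  rw [tsum_mul_left, tsum_geometric_two]
  norm_num

lemma T_eq_phi_add (x : ℝ) : T x = phi x + T (2 * x) / 2 := by
  rw [T, (summable_takagi x).tsum_eq_zero_add, T, ← tsum_div_const]
  congr 1
  · simp
  · refine tsum_congr fun n => ?_
    rw [pow_succ, mul_assoc, div_div]

lemma T_add_one (x : ℝ) : T (x + 1) = T x := by
  refine tsum_congr fun n => ?_
  have h := phi_add_intCast (2 ^ n * x) (2 ^ n)
  push_cast at h
  rw [mul_add, mul_one, h]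

lemma T_half {x : ℝ} (h0 : 0 ≤ x) (h1 : x ≤ 1) : T (x / 2) = x / 2 + T x / 2 := by
  rw [T_eq_phi_add, phi_eq_self (by linarith) (by linarith), mul_div_cancel₀ x two_ne_zero]

lemma T_one_add_half {x : ℝ} (h0 : 0 ≤ x) (h1 : x ≤ 1) :
    T ((1 + x) / 2) = (1 - x) / 2 + T x / 2 := by
  rw [T_eq_phi_add, phi_eq_one_sub (by linarith) (by linarith),
    mul_div_cancel₀ (1 + x) two_ne_zero, add_comm 1 x, T_add_one]
  ring

lemma T_zero : T 0 = 0 := by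
  have h := T_half (x := 0) le_rfl zero_le_one
  norm_num at h
  linarith

lemma T_one_third : T (1 / 3) = 2 / 3 := by
  have h := T_half (x := 2 / 3) (by norm_num) (by norm_num)
  have h' := T_one_add_half (x := 1 / 3) (by norm_num) (by norm_num)
  norm_num at h h' ⊢
  linarith

lemma exists_T_eq {y : ℝ} (hy : y ∈ Icc (0 : ℝ) (2 / 3)) : ∃ x ∈ Ico (0 : ℝ) 1, T x = y := by
  have h := intermediate_value_Icc (a := (0 : ℝ)) (b := 1 / 3) (by norm_num)
    continuous_T.continuousOn
  rw [T_zero, T_one_third] at h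
  obtain ⟨x, hx, rfl⟩ := h hy
  exact ⟨x, ⟨hx.1, by linarith [hx.2]⟩, rfl⟩

/-! ### Prepending binary words -/

/-- The numerical value of a binary digit. -/
def bit (b : Bool) : ℤ := if b then 1 else 0

/-- The real number whose binary expansion is the word `w` followed by the expansion of `t`. -/
noncomputable def prepend : List Bool → ℝ → ℝ
  | [], t => t
  | b :: w, t => (bit b + prepend w t) / 2

/-- The excess of the digits `0` over the digits `1` in a word. -/
def excess : List Bool → ℤ
  | [] => 0
  | b :: w => (1 - 2 * bit b) + excess w

/-- The value of the Takagi function at the dyadic rational with expansion `w`. -/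
noncomputable def wordHeight : List Bool → ℝ
  | [] => 0
  | b :: w => (if b then 1 - prepend w 0 else prepend w 0) / 2 + wordHeight w / 2

lemma prepend_append (u w : List Bool) (t : ℝ) :
    prepend (u ++ w) t = prepend u (prepend w t) := by
  induction u with
  | nil => rfl
  | cons b u ih => simp [prepend, ih]

lemma excess_append (u w : List Bool) : excess (u ++ w) = excess u + excess w := by
  induction u with
  | nil => simp [excess]
  | cons b u ih => simp [excess, ih, add_assoc]

lemma prepend_eq (w : List Bool) (t : ℝ) :
    prepend w t = prepend w 0 + t / 2 ^ w.length := by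
  induction w with
  | nil => simp [prepend]
  | cons b w ih =>
    rw [prepend, ih, prepend, List.length_cons, pow_succ]
    field_simp
    ring

lemma prepend_mem_Icc {t : ℝ} (ht : t ∈ Icc (0 : ℝ) 1) (w : List Bool) :
    prepend w t ∈ Icc (0 : ℝ) 1 := by
  induction w with
  | nil => exact ht
  | cons b w ih =>
    obtain ⟨h0, h1⟩ := ih
    cases b <;> simp only [prepend, bit] <;> constructor <;> norm_num <;> linarith

lemma prepend_mem_Ico {t : ℝ} (ht : t ∈ Ico (0 : ℝ) 1) (w : List Bool) :
    prepend w t ∈ Ico (0 : ℝ) 1 := by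
  induction w with
  | nil => exact ht
  | cons b w ih =>
    obtain ⟨h0, h1⟩ := ih
    cases b <;> simp only [prepend, bit] <;> constructor <;> norm_num <;> linarith

lemma T_prepend {t : ℝ} (ht : t ∈ Icc (0 : ℝ) 1) (w : List Bool) :
    T (prepend w t) = wordHeight w + (excess w * t + T t) / 2 ^ w.length := by
  induction w with
  | nil => simp [prepend, wordHeight, excess]
  | cons b w ih =>
    obtain ⟨h0, h1⟩ := prepend_mem_Icc ht w
    have hw := prepend_eq w t
    cases b
    · simp only [prepend, bit, excess, wordHeight, List.length_cons, pow_succ]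
      norm_num
      rw [T_half h0 h1, ih, hw]
      field_simp
      ring
    · simp only [prepend, bit, excess, wordHeight, List.length_cons, pow_succ]
      norm_num
      rw [T_one_add_half h0 h1, ih, hw]
      field_simp
      ring

lemma T_prepend_of_excess_eq_zero {w : List Bool} (hw : excess w = 0) {t : ℝ}
    (ht : t ∈ Ico (0 : ℝ) 1) : T (prepend w t) = wordHeight w + T t / 2 ^ w.length := by
  rw [T_prepend (Ico_subset_Icc_self ht), hw]
  simp

lemma eps_one_prepend {v : ℝ} (hv : v ∈ Ico (0 : ℝ) 1) (b : Bool) :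
    eps 1 ((bit b + v) / 2) = bit b := by
  have h0 : ⌊v⌋ = 0 := Int.floor_eq_zero_iff.2 hv
  have h1 : ⌊((bit b : ℝ) + v) / 2⌋ = 0 := by
    rw [Int.floor_eq_zero_iff]
    obtain ⟨h0, h1⟩ := hv
    cases b <;> simp only [bit] <;> constructor <;> norm_num <;> linarith
  rw [eps, pow_one, mul_div_cancel₀ _ two_ne_zero, Int.floor_intCast_add, h0]
  simp [h1]

lemma eps_succ_prepend {v : ℝ} (b : Bool) {j : ℕ} (hj : 1 ≤ j) :
    eps (j + 1) ((bit b + v) / 2) = eps j v := by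
  obtain ⟨i, rfl⟩ := Nat.exists_eq_add_of_le' hj
  have h (n : ℕ) : ⌊(2 : ℝ) ^ (n + 1) * ((bit b + v) / 2)⌋ = 2 ^ n * bit b + ⌊(2 : ℝ) ^ n * v⌋ := by
    rw [← Int.floor_intCast_add]
    congr 1
    push_cast
    ring
  simp only [eps, Nat.add_sub_cancel, h]
  ring

lemma D_zero (x : ℝ) : D 0 x = 0 := by simp [D]

lemma D_succ_prepend {v : ℝ} (hv : v ∈ Ico (0 : ℝ) 1) (b : Bool) (k : ℕ) :
    D (k + 1) ((bit b + v) / 2) = (1 - 2 * bit b) + D k v := by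
  induction k with
  | zero => simp [D, eps_one_prepend hv]
  | succ k ih =>
    rw [D, Finset.sum_Icc_succ_top (by omega), ← D, ih, D, D, Finset.sum_Icc_succ_top (by omega),
      eps_succ_prepend b (by omega), add_assoc]

lemma D_prepend {t : ℝ} (ht : t ∈ Ico (0 : ℝ) 1) (w : List Bool) (k : ℕ) :
    D (w.length + k) (prepend w t) = excess w + D k t := by
  induction w with
  | nil => simp [prepend, excess]
  | cons b w ih =>
    rw [List.length_cons, Nat.add_right_comm, prepend, D_succ_prepend (prepend_mem_Ico ht w), ih,
      excess, add_assoc]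

lemma exists_eq_prepend (n : ℕ) : ∀ {x : ℝ}, x ∈ Ico (0 : ℝ) 1 →
    ∃ w : List Bool, w.length = n ∧ ∃ t ∈ Ico (0 : ℝ) 1, x = prepend w t := by
  induction n with
  | zero => exact fun {x} hx => ⟨[], rfl, x, hx, rfl⟩
  | succ n ih =>
    intro x hx
    obtain ⟨h0, h1⟩ := hx
    rcases lt_or_ge x (1 / 2) with h | h
    · obtain ⟨w, hw, t, ht, hx⟩ := ih (x := 2 * x) ⟨by linarith, by linarith⟩
      refine ⟨false :: w, by simp [hw], t, ht, ?_⟩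
      simp [prepend, bit, ← hx]
    · obtain ⟨w, hw, t, ht, hx⟩ := ih (x := 2 * x - 1) ⟨by linarith, by linarith⟩
      refine ⟨true :: w, by simp [hw], t, ht, ?_⟩
      simp [prepend, bit, ← hx]

lemma excess_replicate (b : Bool) (n : ℕ) : excess (List.replicate n b) = n * (1 - 2 * bit b) := by
  induction n with
  | zero => simp [excess]
  | succ n ih =>
    rw [List.replicate_succ, excess, ih]
    push_cast
    ring

lemma exists_append_excess_eq_zero (w : List Bool) : ∃ u, excess (w ++ u) = 0 := by
  refine ⟨List.replicate (excess w).natAbs (decide (0 ≤ excess w)), ?_⟩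
  rw [excess_append, excess_replicate]
  by_cases h : 0 ≤ excess w
  · simp only [h, decide_true, bit, if_true]
    omega
  · simp only [h, decide_false, bit]
    norm_num
    rw [abs_of_neg (not_le.1 h), add_neg_cancel]

/-- Every interval of Takagi values contains the image of a whole hump of the graph. -/
lemma exists_balanced_word {a b : ℝ} (hab : a < b) (h : Ioo a b ⊆ Icc (0 : ℝ) (2 / 3)) :
    ∃ w, excess w = 0 ∧ ∀ t ∈ Ico (0 : ℝ) 1, T (prepend w t) ∈ Ioo a b := by
  have hmid : (a + b) / 2 ∈ Ioo a b := ⟨by linarith, by linarith⟩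
  obtain ⟨x, hx, hTx⟩ := exists_T_eq (h hmid)
  have hopen : IsOpen (T ⁻¹' Ioo a b) := isOpen_Ioo.preimage continuous_T
  obtain ⟨δ, hδ, hball⟩ := Metric.isOpen_iff.1 hopen x (by rw [mem_preimage, hTx]; exact hmid)
  obtain ⟨n, hn⟩ := exists_pow_lt_of_lt_one hδ (by norm_num : (1 / 2 : ℝ) < 1)
  obtain ⟨w, rfl, s, hs, rfl⟩ := exists_eq_prepend n hx
  obtain ⟨u, hu⟩ := exists_append_excess_eq_zero w
  refine ⟨w ++ u, hu, fun t ht => hball ?_⟩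
  have hv := prepend_mem_Ico ht u
  rw [prepend_append, Metric.mem_ball, Real.dist_eq, prepend_eq w (prepend u t), prepend_eq w s,
    add_sub_add_left_eq_sub, ← sub_div, abs_div, abs_of_pos (by positivity : (0 : ℝ) < 2 ^ _)]
  refine lt_of_le_of_lt ?_ hn
  rw [one_div_pow]
  gcongr
  rw [abs_le]
  constructor <;> linarith [hv.1, hv.2, hs.1, hs.2]

/-! ### Families of inequivalent points on a level set -/

lemma loc_tail {w w' : List Bool} (hw : excess w = 0) (hw' : excess w' = 0)
    (hlen : w.length = w'.length) {t t' : ℝ} (ht : t ∈ Ico (0 : ℝ) 1) (ht' : t' ∈ Ico (0 : ℝ) 1)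
    (h : locSetoid (prepend w t) (prepend w' t')) : locSetoid t t' := by
  intro n hn
  have := h (w.length + n) (by omega)
  rwa [D_prepend ht, hlen, D_prepend ht', hw, hw', zero_add, zero_add] at this

/-- `IsLocFamily f y` says that `f` picks points of `L y ∩ [0,1)` from distinct local level
sets. -/
def IsLocFamily {ι : Type} (f : ι → ℝ) (y : ℝ) : Prop :=
  (∀ i, f i ∈ Ico (0 : ℝ) 1 ∧ T (f i) = y) ∧ ∀ i j, locSetoid (f i) (f j) → i = j

lemma IsLocFamily.exists_injective {ι : Type} {f : ι → ℝ} {y : ℝ} (hf : IsLocFamily f y) :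
    ∃ g : ι → locClasses y, Function.Injective g := by
  refine ⟨fun i => ⟨Quotient.mk locSetoid (f i), f i,
    ⟨⟨Ico_subset_Icc_self (hf.1 i).1, (hf.1 i).2⟩, (hf.1 i).1⟩, rfl⟩, fun i j hij => ?_⟩
  exact hf.2 i j (Quotient.exact (congrArg Subtype.val hij))

lemma IsLocFamily.prepend {ι : Type} {f : ι → ℝ} {y : ℝ} (hf : IsLocFamily f y) {w : List Bool}
    (hw : excess w = 0) :
    IsLocFamily (fun i => prepend w (f i)) (wordHeight w + y / 2 ^ w.length) := by
  refine ⟨fun i => ⟨prepend_mem_Ico (hf.1 i).1 w, ?_⟩, fun i j h => ?_⟩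
  · rw [T_prepend_of_excess_eq_zero hw (hf.1 i).1, (hf.1 i).2]
  · exact hf.2 i j (loc_tail hw hw rfl (hf.1 i).1 (hf.1 j).1 h)

/-- Two balanced words of equal length and equal height, but with different excess profiles. -/
def twin : Bool → List Bool
  | false => [false, false, true, true, false, true, false, false, true, false, true, true]
  | true => [false, true, false, false, false, false, false, true, true, true, true, true]

lemma length_twin (b : Bool) : (twin b).length = 12 := by cases b <;> rfl

lemma excess_twin (b : Bool) : excess (twin b) = 0 := by cases b <;> rfl

lemma wordHeight_twin (b : Bool) : wordHeight (twin b) = 69 / 128 := by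
  cases b <;> norm_num [twin, wordHeight, _root_.prepend, bit]

lemma abs_D_two_twin {t : ℝ} (ht : t ∈ Ico (0 : ℝ) 1) (b : Bool) :
    |D 2 (prepend (twin b) t)| = if b then 0 else 2 := by
  cases b
  · have h := D_prepend (prepend_mem_Ico ht ((twin false).drop 2)) [false, false] 0
    rw [← prepend_append, D_zero] at h
    simpa [twin, excess, bit] using congrArg abs h
  · have h := D_prepend (prepend_mem_Ico ht ((twin true).drop 2)) [false, true] 0
    rw [← prepend_append, D_zero] at h
    simpa [twin, excess, bit] using congrArg abs h

lemma twin_eq_of_loc {t t' : ℝ} (ht : t ∈ Ico (0 : ℝ) 1) (ht' : t' ∈ Ico (0 : ℝ) 1) {b b' : Bool}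
    (h : locSetoid (prepend (twin b) t) (prepend (twin b') t')) : b = b' := by
  have h2 := h 2 (by norm_num)
  rw [abs_D_two_twin ht, abs_D_two_twin ht'] at h2
  cases b <;> cases b' <;> simp at h2 ⊢

/-- Prepending twins doubles the size of a family. -/
lemma IsLocFamily.double {k : ℕ} {f : (Fin k → Bool) → ℝ} {y : ℝ} (hf : IsLocFamily f y) :
    IsLocFamily (fun s : Fin (k + 1) → Bool => _root_.prepend (twin (s 0)) (f (Fin.tail s)))
      (69 / 128 + y / 2 ^ 12) := by
  refine ⟨fun s => ⟨prepend_mem_Ico (hf.1 _).1 _, ?_⟩, fun s s' h => ?_⟩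
  · rw [T_prepend_of_excess_eq_zero (excess_twin _) (hf.1 _).1, (hf.1 _).2, wordHeight_twin,
      length_twin]
  · have h0 := twin_eq_of_loc (hf.1 _).1 (hf.1 _).1 h
    have h1 := hf.2 _ _ (loc_tail (excess_twin _) (excess_twin _)
      (by rw [length_twin, length_twin]) (hf.1 _).1 (hf.1 _).1 h)
    rw [← Fin.cons_self_tail s, ← Fin.cons_self_tail s', h0, h1]

lemma exists_interval_locFamily (k : ℕ) : ∃ a b : ℝ, a < b ∧ Ioo a b ⊆ Icc (0 : ℝ) (2 / 3) ∧
    ∀ y ∈ Ioo a b, ∃ f : (Fin k → Bool) → ℝ, IsLocFamily f y := by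
  induction k with
  | zero =>
    refine ⟨0, 2 / 3, by norm_num, Ioo_subset_Icc_self, fun y hy => ?_⟩
    obtain ⟨x, hx, hTx⟩ := exists_T_eq (Ioo_subset_Icc_self hy)
    exact ⟨fun _ => x, fun _ => ⟨hx, hTx⟩, fun i j _ => Subsingleton.elim i j⟩
  | succ k ih =>
    obtain ⟨a, b, hab, hsub, h⟩ := ih
    have key : ∀ y ∈ Ioo (69 / 128 + a / 2 ^ 12) (69 / 128 + b / 2 ^ 12),
        (y - 69 / 128) * 2 ^ 12 ∈ Ioo a b := fun y hy =>
      ⟨by linarith [hy.1], by linarith [hy.2]⟩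
    refine ⟨69 / 128 + a / 2 ^ 12, 69 / 128 + b / 2 ^ 12, by linarith, fun y hy => ?_,
      fun y hy => ?_⟩
    · obtain ⟨h0, h1⟩ := hsub (key y hy)
      constructor <;> linarith
    · obtain ⟨f, hf⟩ := h _ (key y hy)
      have hy' : 69 / 128 + (y - 69 / 128) * 2 ^ 12 / 2 ^ 12 = y := by ring
      exact ⟨_, hy' ▸ hf.double⟩

lemma exists_subinterval_locFamily (k : ℕ) {a b : ℝ} (hab : a < b)
    (h : Ioo a b ⊆ Icc (0 : ℝ) (2 / 3)) : ∃ c d : ℝ, c < d ∧ Ioo c d ⊆ Ioo a b ∧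
      ∀ y ∈ Ioo c d, ∃ f : (Fin k → Bool) → ℝ, IsLocFamily f y := by
  obtain ⟨w, hw, hT⟩ := exists_balanced_word hab h
  obtain ⟨c, d, hcd, hsub, hf⟩ := exists_interval_locFamily k
  have hpos : (0 : ℝ) < 2 ^ w.length := by positivity
  have key : ∀ y ∈ Ioo (wordHeight w + c / 2 ^ w.length) (wordHeight w + d / 2 ^ w.length),
      ∃ z ∈ Ioo c d, y = wordHeight w + z / 2 ^ w.length := by
    intro y hy
    refine ⟨(y - wordHeight w) * 2 ^ w.length, ⟨?_, ?_⟩, ?_⟩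
    · rw [← div_lt_iff₀ hpos]
      linarith [hy.1]
    · rw [← lt_div_iff₀ hpos]
      linarith [hy.2]
    · rw [mul_div_cancel_right₀ _ hpos.ne']
      ring
  refine ⟨wordHeight w + c / 2 ^ w.length, wordHeight w + d / 2 ^ w.length, ?_, fun y hy => ?_,
    fun y hy => ?_⟩
  · gcongr
  · obtain ⟨z, hz, rfl⟩ := key y hy
    obtain ⟨t, ht, rfl⟩ := exists_T_eq (hsub hz)
    rw [← T_prepend_of_excess_eq_zero hw ht]
    exact hT t ht
  · obtain ⟨z, hz, rfl⟩ := key y hy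
    obtain ⟨f, hf⟩ := hf z hz
    exact ⟨_, hf.prepend hw⟩

lemma isNowhereDense_not_locFamily (k : ℕ) : IsNowhereDense
    {y : ℝ | y ∈ Icc (0 : ℝ) (2 / 3) ∧ ¬ ∃ f : (Fin k → Bool) → ℝ, IsLocFamily f y} := by
  set S := {y : ℝ | y ∈ Icc (0 : ℝ) (2 / 3) ∧ ¬ ∃ f : (Fin k → Bool) → ℝ, IsLocFamily f y}
  have hcl : closure S ⊆ Icc (0 : ℝ) (2 / 3) :=
    closure_minimal (fun y hy => hy.1) isClosed_Icc
  rw [IsNowhereDense, eq_empty_iff_forall_notMem]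
  intro y hy
  obtain ⟨δ, hδ, hball⟩ := Metric.isOpen_iff.1 isOpen_interior y hy
  rw [Real.ball_eq_Ioo] at hball
  have hsub := hball.trans interior_subset
  obtain ⟨c, d, hcd, hsub', hf⟩ := exists_subinterval_locFamily k
    (by linarith : y - δ < y + δ) (hsub.trans hcl)
  have hmid : (c + d) / 2 ∈ Ioo c d := ⟨by linarith, by linarith⟩
  obtain ⟨z, hz, hzS⟩ := mem_closure_iff.1 (hsub (hsub' hmid)) _ isOpen_Ioo hmid
  exact hzS.2 (hf z hz)

lemma infinite_locClasses {y : ℝ} (h : ∀ k, ∃ f : (Fin k → Bool) → ℝ, IsLocFamily f y) :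
    (locClasses y).Infinite := by
  intro hfin
  have := hfin.to_subtype
  obtain ⟨f, hf⟩ := h (Nat.card (locClasses y))
  obtain ⟨g, hg⟩ := hf.exists_injective
  have hle := Nat.card_le_card_of_injective g hg
  simp only [Nat.card_fun, Nat.card_eq_fintype_card (α := Bool), Fintype.card_bool,
    Nat.card_eq_fintype_card (α := Fin _), Fintype.card_fin] at hle
  exact absurd hle (not_le.2 Nat.lt_two_pow_self)

/-! ### Level sets with uncountably many local level sets -/

/-- A balanced word with one of two heights. -/
def marker : Bool → List Bool
  | false => [false, false, true, true]
  | true => [false, true, false, true]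

lemma length_marker (b : Bool) : (marker b).length = 4 := by cases b <;> rfl

lemma excess_marker (b : Bool) : excess (marker b) = 0 := by cases b <;> rfl

lemma wordHeight_marker (b : Bool) : wordHeight (marker b) = if b then 5 / 8 else 1 / 2 := by
  cases b <;> norm_num [marker, wordHeight, prepend, bit]

/-- The concatenation of the words `twin (s k) ++ marker (p k)` for `k = 0, 1, …`, read as a
binary expansion. -/
noncomputable def twinPoint (s p : ℕ → Bool) : ℝ :=
  ∑' k, prepend (twin (s k) ++ marker (p k)) 0 * (1 / 2 ^ 16) ^ k

lemma twin_marker_value_mem (a b : Bool) :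
    prepend (twin a ++ marker b) 0 ∈ Icc (0 : ℝ) (1 / 2) := by
  cases a <;> cases b <;> norm_num [twin, marker, prepend, bit]

lemma twinPoint_term_nonneg (s p : ℕ → Bool) (k : ℕ) :
    0 ≤ prepend (twin (s k) ++ marker (p k)) 0 * (1 / 2 ^ 16) ^ k :=
  mul_nonneg (twin_marker_value_mem _ _).1 (by positivity)

lemma twinPoint_term_le (s p : ℕ → Bool) (k : ℕ) :
    prepend (twin (s k) ++ marker (p k)) 0 * (1 / 2 ^ 16) ^ k ≤ 1 / 2 * (1 / 2 ^ 16) ^ k :=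
  mul_le_mul_of_nonneg_right (twin_marker_value_mem _ _).2 (by positivity)

lemma summable_pow_sixteen : Summable fun k : ℕ => (1 / 2 : ℝ) * (1 / 2 ^ 16) ^ k :=
  (summable_geometric_of_lt_one (by norm_num) (by norm_num)).mul_left _

lemma summable_twinPoint (s p : ℕ → Bool) :
    Summable fun k => prepend (twin (s k) ++ marker (p k)) 0 * (1 / 2 ^ 16) ^ k :=
  summable_pow_sixteen.of_nonneg_of_le (twinPoint_term_nonneg s p) (twinPoint_term_le s p)

lemma twinPoint_mem (s p : ℕ → Bool) : twinPoint s p ∈ Ico (0 : ℝ) 1 := by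
  refine ⟨tsum_nonneg (twinPoint_term_nonneg s p), ?_⟩
  refine ((summable_twinPoint s p).tsum_le_tsum (twinPoint_term_le s p)
    summable_pow_sixteen).trans_lt ?_
  rw [tsum_mul_left, tsum_geometric_of_lt_one (by norm_num) (by norm_num)]
  norm_num

lemma twinPoint_eq (s p : ℕ → Bool) : twinPoint s p =
    prepend (twin (s 0))
      (prepend (marker (p 0)) (twinPoint (fun k => s (k + 1)) fun k => p (k + 1))) := by
  rw [← prepend_append, prepend_eq, twinPoint, (summable_twinPoint s p).tsum_eq_zero_add,
    List.length_append, length_twin, length_marker, twinPoint, ← tsum_div_const]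
  congr 1
  · simp
  · refine tsum_congr fun k => ?_
    rw [pow_succ]
    ring

lemma prepend_marker_twinPoint_mem (b : Bool) (s p : ℕ → Bool) :
    prepend (marker b) (twinPoint s p) ∈ Ico (0 : ℝ) 1 :=
  prepend_mem_Ico (twinPoint_mem s p) _

lemma T_twinPoint (s p : ℕ → Bool) : T (twinPoint s p) =
    69 / 128 + (if p 0 then 5 / 8 else 1 / 2) / 2 ^ 12 +
      T (twinPoint (fun k => s (k + 1)) fun k => p (k + 1)) / 2 ^ 16 := by
  rw [twinPoint_eq, T_prepend_of_excess_eq_zero (excess_twin _)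
    (prepend_marker_twinPoint_mem _ _ _), T_prepend_of_excess_eq_zero (excess_marker _)
    (twinPoint_mem _ _), wordHeight_twin, wordHeight_marker, length_twin, length_marker]
  ring

lemma T_twinPoint_congr (s s' p : ℕ → Bool) : T (twinPoint s p) = T (twinPoint s' p) := by
  have h (n : ℕ) : ∀ s s' p : ℕ → Bool,
      |T (twinPoint s p) - T (twinPoint s' p)| ≤ (1 / 2 ^ 16) ^ n := by
    induction n with
    | zero =>
      intro s s' p
      rw [pow_zero, abs_le]
      constructor <;>
        linarith [T_nonneg (twinPoint s p), T_nonneg (twinPoint s' p), T_le_one (twinPoint s p),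
          T_le_one (twinPoint s' p)]
    | succ n ih =>
      intro s s' p
      rw [T_twinPoint s, T_twinPoint s', add_sub_add_left_eq_sub, ← sub_div, abs_div,
        abs_of_pos (by positivity : (0 : ℝ) < 2 ^ 16), pow_succ, div_eq_mul_one_div]
      exact mul_le_mul_of_nonneg_right (ih _ _ _) (by positivity)
  have hlim := tendsto_pow_atTop_nhds_zero_of_lt_one
    (by norm_num : (0 : ℝ) ≤ 1 / 2 ^ 16) (by norm_num)
  have h0 := ge_of_tendsto' hlim fun n => h n s s' p
  exact sub_eq_zero.1 (abs_eq_zero.1 (le_antisymm h0 (abs_nonneg _)))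

lemma T_twinPoint_injective (s : ℕ → Bool) :
    Function.Injective fun p : ℕ → Bool => T (twinPoint s p) := by
  have h (n : ℕ) : ∀ s s' p p' : ℕ → Bool,
      T (twinPoint s p) = T (twinPoint s' p') → p n = p' n := by
    have h0 : ∀ s s' p p' : ℕ → Bool,
        T (twinPoint s p) = T (twinPoint s' p') → p 0 = p' 0 := by
      intro s s' p p' h
      rw [T_twinPoint s, T_twinPoint s'] at h
      have h1 := T_nonneg (twinPoint (fun k => s (k + 1)) fun k => p (k + 1))
      have h2 := T_nonneg (twinPoint (fun k => s' (k + 1)) fun k => p' (k + 1))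
      have h3 := T_le_one (twinPoint (fun k => s (k + 1)) fun k => p (k + 1))
      have h4 := T_le_one (twinPoint (fun k => s' (k + 1)) fun k => p' (k + 1))
      cases hp : p 0 <;> cases hp' : p' 0 <;> simp [hp, hp'] at h ⊢ <;> linarith
    induction n with
    | zero => exact h0
    | succ n ih =>
      intro s s' p p' h
      have hp := h0 s s' p p' h
      rw [T_twinPoint s, T_twinPoint s', hp] at h
      exact ih _ _ (fun k => p (k + 1)) (fun k => p' (k + 1))
        ((div_left_inj' (by norm_num)).1 (add_left_cancel h))
  exact fun p p' hp => funext fun n => h n s s p p' hp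

lemma isLocFamily_twinPoint (s₀ p : ℕ → Bool) :
    IsLocFamily (fun s => twinPoint s p) (T (twinPoint s₀ p)) := by
  refine ⟨fun s => ⟨twinPoint_mem s p, T_twinPoint_congr _ _ _⟩, ?_⟩
  have h (n : ℕ) : ∀ s s' p : ℕ → Bool,
      locSetoid (twinPoint s p) (twinPoint s' p) → s n = s' n := by
    induction n with
    | zero =>
      intro s s' p h
      rw [twinPoint_eq s, twinPoint_eq s'] at h
      exact twin_eq_of_loc (prepend_marker_twinPoint_mem _ _ _)
        (prepend_marker_twinPoint_mem _ _ _) h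
    | succ n ih =>
      intro s s' p h
      rw [twinPoint_eq s, twinPoint_eq s'] at h
      refine ih _ _ _ (loc_tail (excess_marker _) (excess_marker _) rfl (twinPoint_mem _ _)
        (twinPoint_mem _ _) (loc_tail (excess_twin _) (excess_twin _)
        (by rw [length_twin, length_twin]) (prepend_marker_twinPoint_mem _ _ _)
        (prepend_marker_twinPoint_mem _ _ _) h))
  exact fun s s' hs => funext fun n => h n s s' p hs

lemma mk_nat_to_bool : Cardinal.mk (ℕ → Bool) = Cardinal.continuum := by simp

lemma IsLocFamily.not_countable {f : (ℕ → Bool) → ℝ} {y : ℝ} (hf : IsLocFamily f y) :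
    ¬ (locClasses y).Countable := by
  intro hc
  have := hc.to_subtype
  obtain ⟨g, hg⟩ := hf.exists_injective
  have := hg.countable
  have hle : Cardinal.mk (ℕ → Bool) ≤ Cardinal.aleph0 := Cardinal.mk_le_aleph0
  exact (hle.trans_lt Cardinal.aleph0_lt_continuum).ne mk_nat_to_bool

theorem stmt17 :
    IsMeagre {y : ℝ | y ∈ Set.Icc (0:ℝ) (2/3) ∧ ¬ (locClasses y).Infinite} ∧
    ∀ a b : ℝ, a < b → Set.Ioo a b ⊆ Set.Icc (0:ℝ) (2/3) →
      Cardinal.mk {y : ℝ | y ∈ Set.Ioo a b ∧ ¬ (locClasses y).Countable} =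
        Cardinal.continuum := by
  constructor
  · refine IsMeagre.mono ?_ (isMeagre_iUnion fun k => (isNowhereDense_not_locFamily k).isMeagre)
    rintro y ⟨hy, hfin⟩
    by_contra hcon
    refine hfin (infinite_locClasses fun k => ?_)
    by_contra hk
    exact hcon (mem_iUnion.2 ⟨k, hy, hk⟩)
  · intro a b hab hsub
    obtain ⟨w, hw, hT⟩ := exists_balanced_word hab hsub
    apply le_antisymm
    · exact (Cardinal.mk_set_le _).trans_eq Cardinal.mk_real
    · let s : ℕ → Bool := fun _ => false
      have hpos : (0 : ℝ) < 2 ^ w.length := by positivity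
      have hmem (p : ℕ → Bool) : wordHeight w + T (twinPoint s p) / 2 ^ w.length ∈
          {y : ℝ | y ∈ Ioo a b ∧ ¬ (locClasses y).Countable} := by
        refine ⟨?_, ((isLocFamily_twinPoint s p).prepend hw).not_countable⟩
        rw [← T_prepend_of_excess_eq_zero hw (twinPoint_mem s p)]
        exact hT _ (twinPoint_mem s p)
      have hinj : Function.Injective fun p : ℕ → Bool =>
          (⟨_, hmem p⟩ : {y : ℝ | y ∈ Ioo a b ∧ ¬ (locClasses y).Countable}) := by
        intro p p' h
        have h' := add_left_cancel (congrArg Subtype.val h)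
        exact T_twinPoint_injective s ((div_left_inj' hpos.ne').1 h')
      exact mk_nat_to_bool.symm.trans_le (Cardinal.mk_le_of_injective hinj)
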